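/- For every p > 0 and every vector x ∈ ℝⁿ, the bounded-ℓ_{p,σ} norm of x converges to the 0-norm of x as σ → 0⁺; that is, lim_{σ→0⁺} Σ_{i=1}^n (1 - exp(-|x_i|^p / σ^p)) = ||x||₀. -/

import Mathlib

open Real Filter

theorem tendsto_rpow_nhdsGT_zero {p : ℝ} (hp : 0 < p) :
    Tendsto (fun σ : ℝ => σ ^ p) (nhdsWithin 0 (Set.Ioi 0)) (nhdsWithin 0 (Set.Ioi 0)) := by
  refine tendsto_nhdsWithin_iff.2 ⟨?_, ?_⟩
  · simpa [Real.zero_rpow hp.ne'] using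
      (Real.continuousAt_rpow_const 0 p (Or.inr hp.le)).tendsto.mono_left nhdsWithin_le_nhds
  · filter_upwards [self_mem_nhdsWithin] with σ hσ
    exact Real.rpow_pos_of_pos hσ p

theorem tendsto_one_sub_exp_neg_rpow_div {p : ℝ} (hp : 0 < p) (a : ℝ) :
    Tendsto (fun σ : ℝ => 1 - Real.exp (-(|a| ^ p / σ ^ p)))
      (nhdsWithin 0 (Set.Ioi 0)) (nhds (if a ≠ 0 then 1 else 0)) := by
  rcases eq_or_ne a 0 with rfl | ha
  · simp [Real.zero_rpow hp.ne']
  · have h : Tendsto (fun σ : ℝ => |a| ^ p / σ ^ p) (nhdsWithin 0 (Set.Ioi 0)) atTop := by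
      simpa only [div_eq_mul_inv, Function.comp_def] using
        (tendsto_inv_nhdsGT_zero.comp (tendsto_rpow_nhdsGT_zero hp)).const_mul_atTop
          (Real.rpow_pos_of_pos (abs_pos.2 ha) p)
    simpa [ha] using (Real.tendsto_exp_neg_atTop_nhds_zero.comp h).const_sub 1

/-- For every `p > 0` and every vector `x ∈ ℝⁿ`, the bounded-`ℓ_{p,σ}` norm
`∑ i, (1 - exp (-|x i|^p / σ^p))` converges, as `σ → 0⁺`, to the 0-norm of `x`,
i.e. the number of indices `i` with `x i ≠ 0`. -/
theorem bounded_lp_tendsto_zero_norm (n : ℕ) (p : ℝ) (hp : 0 < p) (x : Fin n → ℝ) :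
    Tendsto (fun σ : ℝ => ∑ i : Fin n, (1 - Real.exp (-(|x i| ^ p / σ ^ p))))
      (nhdsWithin 0 (Set.Ioi 0))
      (nhds ((Finset.univ.filter fun i => x i ≠ 0).card : ℝ)) := by
  rw [Finset.card_filter, Nat.cast_sum]
  push_cast
  exact tendsto_finsetSum _ fun i _ => tendsto_one_sub_exp_neg_rpow_div hp (x i)
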